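/- arXiv:cs/0306131 — 4 statements merged into one kernel-verified Lean document; each statement's English description precedes it below -/
import Mathlib

section
/- Let m ≥ 1 and let S ⊆ {1, ..., m-1} satisfy the closure condition: for every p ∈ S and all d₁, d₂ with 0 ≤ d₁, d₂ < m and d₁ + d₂ ≡ p (mod m), it holds that d₁ ∈ S or d₂ ∈ S. Then there exists a natural number g with g ∣ m such that for every natural number x: (x mod m) ∈ S if and only if g does not divide x. -/
/-- Let m ≥ 1 and let S ⊆ {1, ..., m-1} satisfy the closure condition.
Then there exists g ∣ m such that for every natural number x:
(x mod m) ∈ S if and only if g does not divide x. -/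
theorem stmt_3 (m : ℕ) (hm : 1 ≤ m) (S : Set ℕ)
    (hSsub : S ⊆ {x | 0 < x ∧ x < m})
    (hclosed : ∀ p ∈ S, ∀ d₁ d₂ : ℕ, d₁ < m → d₂ < m →
      (d₁ + d₂) % m = p → d₁ ∈ S ∨ d₂ ∈ S) :
    ∃ g : ℕ, g ∣ m ∧ ∀ x : ℕ, (x % m ∈ S ↔ ¬ g ∣ x) := by
  classical
  have h_zero : 0 ∉ S := fun h => (hSsub h).1.ne rfl
  let T : AddSubmonoid ℕ :=
    { carrier := {x | x % m ∉ S}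
      zero_mem' := by simpa using h_zero
      add_mem' := by
        intro a b ha hb hab
        exact (hclosed _ hab (a % m) (b % m) (Nat.mod_lt _ hm) (Nat.mod_lt _ hm)
          (Nat.add_mod a b m).symm).elim ha hb }
  have mem_T (x : ℕ) : x ∈ T ↔ x % m ∉ S := Iff.rfl
  have h_mul {a : ℕ} (k : ℕ) (ha : a ∈ T) : k * a ∈ T := by
    simpa using T.nsmul_mem ha k
  have hmT : m ∈ T := by simpa [mem_T] using h_zero
  have h_ex : ∃ g, 0 < g ∧ g ∈ T := ⟨m, hm, hmT⟩
  obtain ⟨g, ⟨hg_pos, hgT⟩, hg_min⟩ :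
      ∃ g, (0 < g ∧ g ∈ T) ∧ ∀ r < g, ¬ (0 < r ∧ r ∈ T) :=
    ⟨Nat.find h_ex, Nat.find_spec h_ex, fun _ => Nat.find_min h_ex⟩
  have h_mod {x : ℕ} (hx : x ∈ T) : x % g ∈ T := by
    have h_add : x + (m - 1) * (x / g) * g ∈ T := T.add_mem hx (h_mul _ hgT)
    have h_eq : x + (m - 1) * (x / g) * g = x % g + m * (x / g * g) := by
      obtain ⟨n, rfl⟩ := Nat.exists_eq_add_of_le' hm
      rw [Nat.add_sub_cancel]
      linear_combination -Nat.mod_add_div x g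
    rwa [h_eq, mem_T, Nat.add_mul_mod_self_left] at h_add
  have h_dvd {x : ℕ} (hx : x ∈ T) : g ∣ x := by
    by_contra h
    exact hg_min _ (Nat.mod_lt x hg_pos)
      ⟨Nat.pos_of_ne_zero fun h0 => h (Nat.dvd_of_mod_eq_zero h0), h_mod hx⟩
  refine ⟨g, h_dvd hmT, fun x => ⟨?_, fun h => not_not.mp fun hx => h (h_dvd hx)⟩⟩
  rintro hx ⟨k, rfl⟩
  exact (mul_comm k g ▸ h_mul k hgT : g * k ∈ T) hx
end

section
/- Let m ≥ 1 and let S ⊆ {1, ..., m-1} satisfy the closure condition: for every p ∈ S and all d₁, d₂ with 0 ≤ d₁, d₂ < m and d₁ + d₂ ≡ p (mod m), it holds that d₁ ∈ S or d₂ ∈ S. Then there exists a natural number g with g ∣ m such that for every undirected graph G: G has a cycle whose length, modulo m, belongs to S if and only if G has a cycle whose length is not divisible by g. -/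
/-- A set of naturals containing `0`, closed under addition and invariant under congruence
modulo `m ≥ 1` is the set of multiples of a divisor of `m`. -/
theorem exists_dvd_forall_iff_dvd {m : ℕ} (hm : 1 ≤ m) {P : ℕ → Prop} (hzero : P 0)
    (hadd : ∀ a b, P a → P b → P (a + b)) (hmod : ∀ a b, a % m = b % m → P a → P b) :
    ∃ g, g ∣ m ∧ ∀ n, P n ↔ g ∣ n := by
  classical
  have hPm : P m := hmod 0 m (by simp) hzero
  have hex : ∃ n, 0 < n ∧ P n := ⟨m, hm, hPm⟩
  obtain ⟨hpos, hPg⟩ := Nat.find_spec hex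
  set g := Nat.find hex
  have hmul : ∀ k n, P n → P (k * n) := by
    intro k n hn
    induction k with
    | zero => simpa using hzero
    | succ k ih => rw [Nat.succ_mul]; exact hadd _ _ ih hn
  have hdvd : ∀ n, P n → g ∣ n := by
    intro n hn
    have hr : P (n % g) := by
      refine hmod (n + (m - 1) * (n / g) * g) (n % g) ?_ (hadd _ _ hn (hmul _ _ hPg))
      obtain ⟨k, rfl⟩ : ∃ k, m = k + 1 := ⟨m - 1, by omega⟩
      have h : n + (k + 1 - 1) * (n / g) * g = n % g + (k + 1) * (n / g * g) := by
        have h := Nat.mod_add_div n g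
        rw [Nat.add_sub_cancel]
        nlinarith
      rw [h, Nat.add_mul_mod_self_left]
    by_contra hnd
    exact Nat.find_min hex (Nat.mod_lt n hpos)
      ⟨Nat.pos_of_ne_zero fun h => hnd (Nat.dvd_of_mod_eq_zero h), hr⟩
  refine ⟨g, hdvd m hPm, fun n => ⟨hdvd n, ?_⟩⟩
  rintro ⟨k, rfl⟩
  rw [mul_comm]
  exact hmul k g hPg

/-- Let m ≥ 1 and let S ⊆ {1, ..., m-1} satisfy the closure condition.
Then there exists g ∣ m such that for every undirected graph G: G has a cycle whose
length, modulo m, belongs to S iff G has a cycle whose length is not divisible by g. -/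
theorem stmt_4 (m : ℕ) (hm : 1 ≤ m) (S : Set ℕ)
    (hSsub : S ⊆ {x | 0 < x ∧ x < m})
    (hclosed : ∀ p ∈ S, ∀ d₁ d₂ : ℕ, d₁ < m → d₂ < m →
      (d₁ + d₂) % m = p → d₁ ∈ S ∨ d₂ ∈ S) :
    ∃ g : ℕ, g ∣ m ∧ ∀ (V : Type) (G : SimpleGraph V),
      ((∃ (v : V) (c : G.Walk v v), c.IsCycle ∧ c.length % m ∈ S) ↔
       (∃ (v : V) (c : G.Walk v v), c.IsCycle ∧ ¬ g ∣ c.length)) := by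
  obtain ⟨g, hgm, hg⟩ := exists_dvd_forall_iff_dvd hm (P := fun n => n % m ∉ S)
    (fun h => by simpa using (hSsub h).1)
    (fun a b ha hb h => (hclosed _ h (a % m) (b % m) (Nat.mod_lt _ hm) (Nat.mod_lt _ hm)
      (Nat.add_mod a b m).symm).elim ha hb)
    (fun a b h ha => h ▸ ha)
  refine ⟨g, hgm, fun V G => ?_⟩
  simp only [← hg, not_not]
end

section
/- Let m ≥ 1 and let S ⊆ {1, ..., m-1} satisfy the closure condition: for every p ∈ S and all d₁, d₂ with 0 ≤ d₁, d₂ < m and d₁ + d₂ ≡ p (mod m), it holds that d₁ ∈ S or d₂ ∈ S. If a directed graph G has a closed walk W whose length, modulo m, belongs to S, then G has a cycle whose length, modulo m, belongs to S. -/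
/-- `u` (a sequence of `k+1` vertices) is a walk of length `k ≥ 1` in the directed
graph with edge relation `E` (self-loops allowed). -/
def IsDirWalk {V : Type*} (E : V → V → Prop) (k : ℕ) (u : Fin (k + 1) → V) : Prop :=
  1 ≤ k ∧ ∀ i : Fin k, E (u i.castSucc) (u i.succ)

/-- `u` is a closed walk of length `k` in the directed graph `E`:
a walk whose first and last vertices coincide. -/
def IsDirClosedWalk {V : Type*} (E : V → V → Prop) (k : ℕ) (u : Fin (k + 1) → V) : Prop :=
  IsDirWalk E k u ∧ u 0 = u (Fin.last k)

/-- `u` is a cycle of length `k` in the directed graph `E`: a closed walk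
`(u₀, …, u_{k-1}, u₀)` in which `u₀, …, u_{k-1}` are `k` distinct vertices. -/
def IsDirCycle {V : Type*} (E : V → V → Prop) (k : ℕ) (u : Fin (k + 1) → V) : Prop :=
  IsDirClosedWalk E k u ∧ Function.Injective fun i : Fin k => u i.castSucc

/-- A closed walk, given as a sequence indexed by `ℕ`, whose length modulo `m` lies in `S`
yields a cycle with the same property, provided a sum lying in `S` modulo `m` always has a
summand lying in `S` modulo `m`. -/
theorem exists_isDirCycle_of_closed_seq {V : Type*} {E : V → V → Prop} {m : ℕ} {S : Set ℕ}
    (hS : ∀ a b : ℕ, (a + b) % m ∈ S → a % m ∈ S ∨ b % m ∈ S) (k : ℕ) (w : ℕ → V)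
    (hk : 1 ≤ k) (hE : ∀ i < k, E (w i) (w (i + 1))) (hw : w 0 = w k) (hkS : k % m ∈ S) :
    ∃ (ℓ : ℕ) (C : Fin (ℓ + 1) → V), IsDirCycle E ℓ C ∧ ℓ % m ∈ S := by
  induction k using Nat.strong_induction_on generalizing w with
  | _ k ih =>
    by_cases hinj : Set.InjOn w (Set.Iio k)
    · refine ⟨k, fun i => w i, ⟨⟨⟨hk, fun i => ?_⟩, ?_⟩, fun i j hij => ?_⟩, hkS⟩
      · simpa using hE i i.isLt
      · simpa using hw
      · exact Fin.ext (hinj i.isLt j.isLt (by simpa using hij))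
    · obtain ⟨i, j, hij, hj, hwij⟩ : ∃ i j, i < j ∧ j < k ∧ w i = w j := by
        simp only [Set.InjOn, Set.mem_Iio] at hinj
        push Not at hinj
        obtain ⟨i, hi, j, hj, h, hne⟩ := hinj
        rcases lt_or_gt_of_ne hne with hlt | hlt
        · exact ⟨i, j, hlt, hj, h⟩
        · exact ⟨j, i, hlt, hi, h.symm⟩
      have hsum : (j - i) + (k - (j - i)) = k := by omega
      rcases hS (j - i) (k - (j - i)) (hsum.symm ▸ hkS) with h | h
      · refine ih (j - i) (by omega) (fun n => w (i + n)) (by omega) (fun n hn => ?_) ?_ h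
        · exact hE (i + n) (by omega)
        · simpa [Nat.add_sub_cancel' hij.le] using hwij
      · refine ih (k - (j - i)) (by omega) (fun n => if n ≤ i then w n else w (n + (j - i)))
          (by omega) (fun n hn => ?_) ?_ h
        · rcases lt_trichotomy n i with hni | rfl | hni
          · simpa [hni.le, Nat.succ_le_of_lt hni] using hE n (by omega)
          · have hj' : n + 1 + (j - n) = j + 1 := by omega
            simpa [hj', hwij] using hE j hj
          · have hn' : n + 1 + (j - i) = n + (j - i) + 1 := by omega
            simpa [hni.not_ge, (Nat.lt_succ_of_lt hni).not_ge, hn'] using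
              hE (n + (j - i)) (by omega)
        · have hle : ¬ k - (j - i) ≤ i := by omega
          have hk' : k - (j - i) + (j - i) = k := by omega
          simpa [hle, hk'] using hw

/-- Let m ≥ 1 and let S ⊆ {1, ..., m-1} satisfy the closure condition.
If a directed graph G has a closed walk W whose length, modulo m, belongs to S, then
G has a cycle whose length, modulo m, belongs to S. -/
theorem stmt_5 {V : Type*} (m : ℕ) (hm : 1 ≤ m) (S : Set ℕ)
    (hSsub : S ⊆ {x | 0 < x ∧ x < m})
    (hclosed : ∀ p ∈ S, ∀ d₁ d₂ : ℕ, d₁ < m → d₂ < m →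
      (d₁ + d₂) % m = p → d₁ ∈ S ∨ d₂ ∈ S)
    (E : V → V → Prop) (k : ℕ) (W : Fin (k + 1) → V)
    (hW : IsDirClosedWalk E k W) (hWS : k % m ∈ S) :
    ∃ (ℓ : ℕ) (C : Fin (ℓ + 1) → V), IsDirCycle E ℓ C ∧ ℓ % m ∈ S := by
  have hS : ∀ a b : ℕ, (a + b) % m ∈ S → a % m ∈ S ∨ b % m ∈ S := fun a b h =>
    hclosed _ h (a % m) (b % m) (Nat.mod_lt _ hm) (Nat.mod_lt _ hm) (Nat.add_mod a b m).symm
  obtain ⟨⟨hk, hE⟩, hclose⟩ := hW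
  refine exists_isDirCycle_of_closed_seq hS k (fun n => W (Fin.ofNat (k + 1) n)) hk
    (fun i hi => ?_) ?_ hWS
  · have h₁ : Fin.ofNat (k + 1) i = (⟨i, hi⟩ : Fin k).castSucc :=
      Fin.ext (Nat.mod_eq_of_lt (by omega))
    have h₂ : Fin.ofNat (k + 1) (i + 1) = (⟨i, hi⟩ : Fin k).succ :=
      Fin.ext (Nat.mod_eq_of_lt (by omega))
    simpa only [h₁, h₂] using hE ⟨i, hi⟩
  · have h₁ : Fin.ofNat (k + 1) 0 = 0 := rfl
    have h₂ : Fin.ofNat (k + 1) k = Fin.last k := Fin.ext (Nat.mod_eq_of_lt (by simp))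
    simpa only [h₁, h₂] using hclose
end

section
/- Let m ≥ 2 and let S ⊆ {1, ..., m-1} satisfy the closure condition: for every p ∈ S and all d₁, d₂ with 0 ≤ d₁, d₂ < m and d₁ + d₂ ≡ p (mod m), it holds that d₁ ∈ S or d₂ ∈ S. Let G be a directed graph and let W be a closed walk in G whose length, modulo m, belongs to S, and suppose the length of W is minimal among all closed walks of G whose length, modulo m, belongs to S. Then W is a cycle. -/
/-- An `ℕ`-indexed sequence that follows edges for `k ≥ 1` steps and returns to its start
restricts to a closed walk of length `k`. -/
theorem isDirClosedWalk_of_nat {V : Type*} {E : V → V → Prop} {k : ℕ} (f : ℕ → V)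
    (hk : 1 ≤ k) (hE : ∀ n < k, E (f n) (f (n + 1))) (hf : f 0 = f k) :
    IsDirClosedWalk E k fun i => f i :=
  ⟨⟨hk, fun i => by simpa using hE i i.isLt⟩, by simpa using hf⟩

/-- A walk indexed by `Fin (k + 1)` extends to an `ℕ`-indexed sequence. -/
theorem IsDirClosedWalk.exists_nat {V : Type*} {E : V → V → Prop} {k : ℕ} {u : Fin (k + 1) → V}
    (hu : IsDirClosedWalk E k u) :
    ∃ f : ℕ → V, (∀ i : Fin (k + 1), f i = u i) ∧ (∀ n < k, E (f n) (f (n + 1))) ∧ f 0 = f k := by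
  have hf (i : Fin (k + 1)) : u (Fin.ofNat (k + 1) i) = u i := by simp
  refine ⟨fun n => u (Fin.ofNat (k + 1) n), hf, fun n hn => ?_, ?_⟩
  · have h := hu.1.2 ⟨n, hn⟩
    rw [← hf, ← hf (Fin.succ _)] at h
    exact h
  · have h := hu.2
    rw [← hf, ← hf (Fin.last k)] at h
    exact h

/-- A closed walk that repeats a vertex splits into two closed walks: the part between the two
visits, and what is left once that part is removed. -/
theorem IsDirClosedWalk.exists_split {V : Type*} {E : V → V → Prop} {k : ℕ}
    {u : Fin (k + 1) → V} (hu : IsDirClosedWalk E k u) {a b : Fin k} (hab : a < b)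
    (h : u a.castSucc = u b.castSucc) :
    ∃ k₁ k₂ : ℕ, k₁ + k₂ = k ∧ (∃ v, IsDirClosedWalk E k₁ v) ∧ ∃ w, IsDirClosedWalk E k₂ w := by
  obtain ⟨f, hf, hE, hclosed⟩ := hu.exists_nat
  obtain ⟨i, hi⟩ := a
  obtain ⟨j, hj⟩ := b
  replace hab : i < j := hab
  rw [← hf, ← hf] at h
  replace h : f i = f j := h
  obtain ⟨d, rfl⟩ := Nat.exists_eq_add_of_lt hab
  refine ⟨d + 1, k - (d + 1), by omega,
    ⟨_, isDirClosedWalk_of_nat (fun n => f (i + n)) (by omega)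
      (fun n hn => hE (i + n) (by omega)) h⟩,
    ⟨_, isDirClosedWalk_of_nat (fun n => if n ≤ i then f n else f (n + (d + 1))) (by omega)
      (fun n hn => ?_) ?_⟩⟩
  · rcases lt_trichotomy n i with hni | rfl | hni
    · simpa [hni.le, Nat.succ_le_of_lt hni] using hE n (by omega)
    · have := hE (n + d + 1) (by omega)
      rw [← h] at this
      simpa [add_assoc, add_comm, add_left_comm] using this
    · have := hE (n + (d + 1)) (by omega)
      rw [show n + (d + 1) + 1 = n + 1 + (d + 1) by omega] at this
      simpa [hni.not_ge, show ¬ n + 1 ≤ i by omega] using this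
  · simp [show ¬ k - (d + 1) ≤ i by omega, show k - (d + 1) + (d + 1) = k by omega, hclosed]

/-- Let m ≥ 2 and let S ⊆ {1, ..., m-1} satisfy the closure condition.
Let W be a closed walk in a directed graph G whose length, modulo m, belongs to S, of
minimal length among all such closed walks. Then W is a cycle. -/
theorem stmt_11 {V : Type*} (m : ℕ) (hm : 2 ≤ m) (S : Set ℕ)
    (hSsub : S ⊆ {x | 0 < x ∧ x < m})
    (hclosed : ∀ p ∈ S, ∀ d₁ d₂ : ℕ, d₁ < m → d₂ < m →
      (d₁ + d₂) % m = p → d₁ ∈ S ∨ d₂ ∈ S)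
    (E : V → V → Prop) (k : ℕ) (W : Fin (k + 1) → V)
    (hW : IsDirClosedWalk E k W) (hWS : k % m ∈ S)
    (hmin : ∀ (k' : ℕ) (W' : Fin (k' + 1) → V),
      IsDirClosedWalk E k' W' → k' % m ∈ S → k ≤ k') :
    IsDirCycle E k W := by
  refine ⟨hW, .of_lt_imp_ne fun a b hab h => ?_⟩
  obtain ⟨k₁, k₂, rfl, ⟨v, hv⟩, w, hw⟩ := hW.exists_split hab h
  have hk₁ := hv.1.1
  have hk₂ := hw.1.1
  have hm₀ : 0 < m := by omega
  rcases hclosed _ hWS (k₁ % m) (k₂ % m) (Nat.mod_lt _ hm₀) (Nat.mod_lt _ hm₀)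
    (Nat.add_mod _ _ _).symm with h₁ | h₂
  · have := hmin k₁ v hv h₁
    omega
  · have := hmin k₂ w hw h₂
    omega
end
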